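/- Operator inequality between i.i.d. mixtures and type-class averages. Let X be a finite alphabet, (σ_x)_{x∈X} a family of quantum states on ℂ^d, n ≥ 1, and V an n-type on X (a probability distribution V : X → [0,1] with nV(x) ∈ ℕ for all x). Let T_{n,V} ⊆ X^n be the type class of V (the set of strings of length n in which each symbol x occurs exactly nV(x) times) and set γ_{n,V} := |T_{n,V}|^{−1} Σ_{x^n ∈ T_{n,V}} σ_{x₁} ⊗ … ⊗ σ_{x_n}. Then in the Loewner order (Σ_{x∈X} V(x) σ_x)^{⊗n} ≥ V^{⊗n}(T_{n,V}) · γ_{n,V} ≥ (n+1)^{−|X|} γ_{n,V}, where V^{⊗n}(T_{n,V}) = Σ_{x^n∈T_{n,V}} ∏_k V(x_k). -/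

import Mathlib

open Filter MeasureTheory Topology
open scoped BigOperators Classical ComplexOrder

noncomputable section

namespace QSanov

/-- Matrices representing operators on the single-copy Hilbert space with orthonormal
basis indexed by `ι`. -/
abbrev MatC (ι : Type*) := Matrix ι ι ℂ

/-- Matrices representing operators on the `n`-fold tensor power Hilbert space. -/
abbrev MatN (ι : Type*) (n : ℕ) := Matrix (Fin n → ι) (Fin n → ι) ℂ

instance matMeasurableSpace (m n : Type*) : MeasurableSpace (Matrix m n ℂ) :=
  inferInstanceAs (MeasurableSpace (m → n → ℂ))

/-- A quantum state: a positive semidefinite matrix of trace one. -/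
def IsState {κ : Type*} [Fintype κ] (ρ : Matrix κ κ ℂ) : Prop :=
  ρ.PosSemidef ∧ ρ.trace = 1

/-- Loewner order: `A ≤ B` iff `B - A` is positive semidefinite. -/
def loewnerLE {κ : Type*} [Fintype κ] (A B : Matrix κ κ ℂ) : Prop :=
  (B - A).PosSemidef

/-- The `n`-fold tensor power `ρ^{⊗n}` of a single-copy matrix. -/
def tensorPow {ι : Type*} (ρ : MatC ι) (n : ℕ) : MatN ι n :=
  fun i j => ∏ k, ρ (i k) (j k)

/-- The tensor product `ρ₁ ⊗ ⋯ ⊗ ρ_n` of a family of single-copy matrices. -/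
def tensorProdFam {ι : Type*} {n : ℕ} (ρ : Fin n → MatC ι) : MatN ι n :=
  fun i j => ∏ k, ρ k (i k) (j k)

/-- The tensor product of an `n`-copy matrix and an `m`-copy matrix. -/
def tensorMul {ι : Type*} {n m : ℕ} (ρ : MatN ι n) (σ : MatN ι m) : MatN ι (n + m) :=
  fun i j => ρ (fun t => i (Fin.castAdd m t)) (fun t => j (Fin.castAdd m t)) *
    σ (fun t => i (Fin.natAdd n t)) (fun t => j (Fin.natAdd n t))

/-- Conjugation `U_π ρ U_π†` by the unitary permuting the `n` tensor factors. -/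
def permCopies {ι : Type*} {n : ℕ} (π : Equiv.Perm (Fin n)) (ρ : MatN ι n) : MatN ι n :=
  fun i j => ρ (i ∘ π) (j ∘ π)

/-- Matrix logarithm via functional calculus on the support (eigenvalue `0` is sent
to `0`, since `Real.log 0 = 0`). -/
def matLog {κ : Type*} [Fintype κ] [DecidableEq κ] (A : Matrix κ κ ℂ) : Matrix κ κ ℂ :=
  if hA : A.IsHermitian then
    (hA.eigenvectorUnitary : Matrix κ κ ℂ) *
      (Matrix.diagonal fun i => (Real.log (hA.eigenvalues i) : ℂ)) *
      (star (hA.eigenvectorUnitary : Matrix κ κ ℂ))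
  else 0

/-- Support inclusion `supp ρ ⊆ supp σ`, phrased as inclusion of ranges. -/
def suppLE {κ : Type*} [Fintype κ] [DecidableEq κ] (ρ σ : Matrix κ κ ℂ) : Prop :=
  LinearMap.range (Matrix.toLin' ρ) ≤ LinearMap.range (Matrix.toLin' σ)

/-- Umegaki relative entropy `D(ρ‖σ) = Tr[ρ (log ρ - log σ)]`, equal to `+∞` when
`supp ρ ⊄ supp σ`. -/
def relEnt {κ : Type*} [Fintype κ] [DecidableEq κ] (ρ σ : Matrix κ κ ℂ) : EReal :=
  if suppLE ρ σ then (((ρ * (matLog ρ - matLog σ)).trace.re : ℝ) : EReal) else ⊤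

/-- Relative entropy between two sets of states: `D(𝒜‖ℬ) = inf_{ρ∈𝒜, σ∈ℬ} D(ρ‖σ)`. -/
def relEntSet {κ : Type*} [Fintype κ] [DecidableEq κ] (A B : Set (Matrix κ κ ℂ)) : EReal :=
  ⨅ ρ ∈ A, ⨅ σ ∈ B, relEnt ρ σ

/-- The composite i.i.d. hypothesis `𝒻₁^{⊗n, iid}` built on the base set `F1`. -/
def iidSet {ι : Type*} (F1 : Set (MatC ι)) (n : ℕ) : Set (MatN ι n) :=
  {ρ | ∃ σ ∈ F1, ρ = tensorPow σ n}

/-- The arbitrarily varying hypothesis `𝒻₁^{⊗n, av}` built on the base set `F1`. -/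
def avSet {ι : Type*} (F1 : Set (MatC ι)) (n : ℕ) : Set (MatN ι n) :=
  {ρ | ∃ f : Fin n → MatC ι, (∀ p, f p ∈ F1) ∧ ρ = tensorProdFam f}

/-- Worst-case type II error probability `β_ε(A‖B)` for a threshold `ε` on the
worst-case type I error probability. -/
def typeII {κ : Type*} [Fintype κ] [DecidableEq κ] (A B : Set (Matrix κ κ ℂ)) (ε : ℝ) : ℝ :=
  sInf {b : ℝ | ∃ E : Matrix κ κ ℂ, E.PosSemidef ∧ (1 - E).PosSemidef ∧
    (∀ ρ ∈ A, (ρ * (1 - E)).trace.re ≤ ε) ∧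
    b = sSup {x : ℝ | ∃ σ ∈ B, x = (σ * E).trace.re}}

/-- `- log x`, with value `+∞` for `x ≤ 0`. -/
def negLog (x : ℝ) : EReal := if x ≤ 0 then ⊤ else ((-Real.log x : ℝ) : EReal)

/-- `(1/n : EReal)`. -/
def cFrac (n : ℕ) : EReal := (((n : ℝ)⁻¹ : ℝ) : EReal)

/-- The Stein exponent `Stein(𝒜‖ℬ) = lim_{ε→0⁺} liminf_n -(1/n) log β_ε(𝒜_n‖ℬ_n)`;
since the inner quantity is monotone nondecreasing in `ε`, the limit as `ε → 0⁺`
coincides with the infimum over `ε ∈ (0,1)`. -/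
def steinExponent {ι : Type*} [Fintype ι] [DecidableEq ι]
    (A B : ∀ n : ℕ, Set (MatN ι n)) : EReal :=
  ⨅ ε ∈ Set.Ioo (0 : ℝ) 1,
    Filter.liminf (fun n : ℕ => cFrac n * negLog (typeII (A n) (B n) ε)) Filter.atTop

/-- The mixture `∫ dμ(σ) σ^{⊗n}` of i.i.d. states along a measure `μ` on a set of
states `C` (Bochner integral, computed entrywise). -/
def iidMix {ι : Type*} {C : Set (MatC ι)} (μ : Measure ↥C) (n : ℕ) : MatN ι n :=
  fun i j => ∫ σ, (∏ k, (σ : MatC ι) (i k) (j k)) ∂μ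

/-- The `b`-th block of size `k` of an index of `ℋ^{⊗ mk}`. -/
def blockOf {ι : Type*} {m k : ℕ} (i : Fin (m * k) → ι) (b : Fin m) : Fin k → ι :=
  fun t => i (finProdFinEquiv (b, t))

/-- Replace the blocks in `S` of the index `i` by the values prescribed by `c`. -/
def mergeBlocks {ι : Type*} {m k : ℕ} (S : Finset (Fin m)) (c : Fin m → Fin k → ι)
    (i : Fin (m * k) → ι) : Fin (m * k) → ι :=
  fun p => if (finProdFinEquiv.symm p).1 ∈ S
    then c (finProdFinEquiv.symm p).1 (finProdFinEquiv.symm p).2 else i p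

/-- Entry `(i,j)` of the partial trace of `ρ` over the blocks in `S`
(the remaining blocks being evaluated at `i`, `j`). -/
def blockPartialTrace {ι : Type*} [Fintype ι] {m k : ℕ} (S : Finset (Fin m))
    (ρ : MatN ι (m * k)) (i j : Fin (m * k) → ι) : ℂ :=
  (((Fintype.card ι : ℂ) ^ (k * (m - S.card)))⁻¹) *
    ∑ c : Fin m → Fin k → ι, ρ (mergeBlocks S c i) (mergeBlocks S c j)

/-- The `m`-fold tensor power `(𝒩^δ_ω)^{⊗ m}` of the depolarising channel
`𝒩^δ_ω(X) = (1-δ) X + δ Tr[X] ω`, acting blockwise on blocks of `k` tensor factors. -/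
def blockDepolarize {ι : Type*} [Fintype ι] (δ : ℝ) {k : ℕ} (ω : MatN ι k) (m : ℕ)
    (ρ : MatN ι (m * k)) : MatN ι (m * k) :=
  fun i j => ∑ S : Finset (Fin m),
    (((1 - δ) ^ (m - S.card) * δ ^ S.card : ℝ) : ℂ) *
      ((∏ b ∈ S, ω (blockOf i b) (blockOf j b)) * blockPartialTrace S ρ i j)

/-- The `m`-fold tensor power of a `k`-copy matrix, as an `mk`-copy matrix. -/
def powBlocks {ι : Type*} {k : ℕ} (ρ : MatN ι k) (m : ℕ) : MatN ι (m * k) :=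
  fun i j => ∏ b : Fin m, ρ (blockOf i b) (blockOf j b)

/-- `Tr_{n+1,…,n+k}[ρ (𝟙^{⊗n} ⊗ F)]`, the filtered reduction of an `(n+k)`-copy matrix. -/
def condReduce {ι : Type*} [Fintype ι] {n k : ℕ} (ρ : MatN ι (n + k)) (F : MatN ι k) :
    MatN ι n :=
  fun i j => ∑ a : Fin k → ι, ∑ b : Fin k → ι,
    ρ (Fin.append i a) (Fin.append j b) * F b a

/-- Partial trace over the `k`-th tensor factor. -/
def traceOutAt {ι : Type*} [Fintype ι] {n : ℕ} (k : Fin (n + 1)) (σ : MatN ι (n + 1)) :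
    MatN ι n :=
  fun i j => ∑ a : ι, σ (k.insertNth a i) (k.insertNth a j)

/-- Insert the single-copy state `τ` at position `k` into an `n`-copy matrix. -/
def insertState {ι : Type*} {n : ℕ} (k : Fin (n + 1)) (τ : MatC ι) (σ : MatN ι n) :
    MatN ι (n + 1) :=
  fun i j => τ (i k) (j k) *
    σ (fun t => i (k.succAbove t)) (fun t => j (k.succAbove t))

/-- Product of a state on `A^n` and a state on `B^n`, viewed as a state on
`(ℋ_A ⊗ ℋ_B)^{⊗ n}` (reordering tensor factors implicitly). -/
def prodStateAB {ιA ιB : Type*} {n : ℕ} (α : Matrix (Fin n → ιA) (Fin n → ιA) ℂ)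
    (β : Matrix (Fin n → ιB) (Fin n → ιB) ℂ) : MatN (ιA × ιB) n :=
  fun i j => α (fun k => (i k).1) (fun k => (j k).1) * β (fun k => (i k).2) (fun k => (j k).2)


/-- The set `𝒮_{A^n:B^n}` of separable states across the cut `A^n : B^n`. -/
def sepSet (ιA ιB : Type*) [Fintype ιA] [Fintype ιB] (n : ℕ) : Set (MatN (ιA × ιB) n) :=
  convexHull ℝ {ρ | ∃ α β, IsState α ∧ IsState β ∧ ρ = prodStateAB α β}

/-- Classical relative entropy of two finitely supported output distributions. -/
def clRelEnt {m : ℕ} (P Q : Fin m → ℝ) : EReal :=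
  ∑ x, (if P x = 0 then (0 : EReal) else if Q x = 0 then (⊤ : EReal)
    else ((P x * Real.log (P x / Q x) : ℝ) : EReal))

/-- Measured relative entropy: supremum over all finite POVMs of the classical
relative entropy of the induced outcome distributions. -/
def measuredRelEnt {κ : Type*} [Fintype κ] [DecidableEq κ] (ρ σ : Matrix κ κ ℂ) : EReal :=
  ⨆ (m : ℕ) (E : Fin m → Matrix κ κ ℂ) (_ : ∀ x, (E x).PosSemidef) (_ : ∑ x, E x = 1),
    clRelEnt (fun x => (ρ * E x).trace.re) (fun x => (σ * E x).trace.re)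


/-- Axiom Q.I: there is a full-support free state `τ ∈ 𝒜₁` such that every `𝒜_{mk}`
is stable under blockwise depolarising towards `τ^{⊗k}`. -/
def AxiomQI {ι : Type*} [Fintype ι] [DecidableEq ι] (A : ∀ n : ℕ, Set (MatN ι n)) : Prop :=
  ∃ τ : MatC ι, tensorPow τ 1 ∈ A 1 ∧
    ∀ m k : ℕ, 1 ≤ m → 1 ≤ k → ∀ ρ ∈ A (m * k),
      suppLE ρ (tensorPow τ (m * k)) ∧
      ∀ δ ∈ Set.Icc (0 : ℝ) 1, blockDepolarize δ (tensorPow τ k) m ρ ∈ A (m * k)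

/-- Axiom Q.II: closedness under tensor powers. -/
def AxiomQII {ι : Type*} (A : ∀ n : ℕ, Set (MatN ι n)) : Prop :=
  ∀ m k : ℕ, 1 ≤ m → 1 ≤ k → ∀ ρ ∈ A k, powBlocks ρ m ∈ A (m * k)

/-- Axiom Q.III: closedness under permutations of the tensor factors. -/
def AxiomQIII {ι : Type*} (A : ∀ n : ℕ, Set (MatN ι n)) : Prop :=
  ∀ n : ℕ, ∀ ρ ∈ A n, ∀ π : Equiv.Perm (Fin n), permCopies π ρ ∈ A n

/-- Axiom Q.IV: filtering by Hermitian operators in a neighbourhood of the identity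
is completely `cone(𝒜)`-preserving. -/
def AxiomQIV {ι : Type*} [Fintype ι] [DecidableEq ι] (A : ∀ n : ℕ, Set (MatN ι n)) : Prop :=
  ∀ k : ℕ, 1 ≤ k →
    ∃ V : Set (MatN ι k), V ∈ nhds (1 : MatN ι k) ∧
      ∀ F ∈ V, F.IsHermitian → ∀ n : ℕ, 1 ≤ n → ∀ ρ ∈ A (n + k),
        ∃ (lam : ℝ) (ω : MatN ι n), 0 ≤ lam ∧ ω ∈ A n ∧ condReduce ρ F = (lam : ℂ) • ω


/-- The tensor product of positive semidefinite matrices is positive semidefinite. -/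
lemma posSemidef_tensorProdFam {ι : Type*} [Fintype ι] {n : ℕ} {ρ : Fin n → MatC ι}
    (hρ : ∀ k, (ρ k).PosSemidef) : (tensorProdFam ρ).PosSemidef := by
  have hsq : ∀ k, ∃ B : MatC ι, ρ k = B.conjTranspose * B := by
    intro k
    open scoped MatrixOrder in
    exact CStarAlgebra.nonneg_iff_eq_star_mul_self.mp (hρ k).nonneg
  choose B hB using hsq
  have h : tensorProdFam ρ = (tensorProdFam B).conjTranspose * tensorProdFam B := by
    ext i j
    simp only [tensorProdFam, hB, Matrix.mul_apply, Matrix.conjTranspose_apply, star_prod,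
      ← Finset.prod_mul_distrib]
    rw [Finset.prod_univ_sum, Fintype.piFinset_univ]
  rw [h]
  exact Matrix.posSemidef_conjTranspose_mul_self _

/-- Expansion of the tensor power of a linear combination. -/
lemma tensorPow_sum_smul {X ι : Type*} [Fintype X] (v : X → ℂ) (σ : X → MatC ι) (n : ℕ) :
    tensorPow (∑ x, v x • σ x) n =
      ∑ s : Fin n → X, (∏ k, v (s k)) • tensorProdFam (fun k => σ (s k)) := by
  ext i j
  simp only [tensorPow, tensorProdFam, Matrix.sum_apply, Matrix.smul_apply, smul_eq_mul,
    ← Finset.prod_mul_distrib]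
  rw [Finset.prod_univ_sum, Fintype.piFinset_univ]

lemma prod_comp_eq_prod_pow_card {X M : Type*} [Fintype X] [DecidableEq X] [CommMonoid M] {n : ℕ}
    (f : X → M) (s : Fin n → X) :
    ∏ k, f (s k) = ∏ x, f x ^ (Finset.univ.filter fun k => s k = x).card := by
  rw [← Finset.prod_fiberwise Finset.univ s fun k => f (s k)]
  refine Finset.prod_congr rfl fun x _ => ?_
  rw [Finset.prod_congr rfl (g := fun _ => f x) (by simp +contextual), Finset.prod_const]

/-- The size of a type class is a multinomial coefficient. -/
lemma card_typeClass {X : Type*} [Fintype X] [DecidableEq X] {n : ℕ} (c : X → ℕ)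
    (hc : ∑ x, c x = n) :
    (Finset.univ.filter fun s : Fin n → X =>
      ∀ x, (Finset.univ.filter fun k => s k = x).card = c x).card =
      Nat.multinomial Finset.univ c := by
  have hmon : ∀ q : X → ℕ, ∏ x, (MvPolynomial.X x : MvPolynomial X ℕ) ^ q x =
      MvPolynomial.monomial (Finsupp.equivFunOnFinite.symm q) 1 := by
    intro q
    rw [MvPolynomial.monomial_eq, Finsupp.prod_fintype _ _ (by simp)]
    simp
  have hfun : (∑ x, (MvPolynomial.X x : MvPolynomial X ℕ)) ^ n =
      ∑ s : Fin n → X, ∏ k, MvPolynomial.X (s k) := by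
    rw [← Fintype.piFinset_univ, ← Finset.prod_univ_sum, Finset.prod_const, Finset.card_univ,
      Fintype.card_fin]
  rw [Finset.sum_pow_eq_sum_piAntidiag] at hfun
  have hcoeff := congrArg (MvPolynomial.coeff (Finsupp.equivFunOnFinite.symm c)) hfun
  simp only [prod_comp_eq_prod_pow_card, hmon, MvPolynomial.coeff_sum, ← map_natCast
    (MvPolynomial.C : ℕ →+* MvPolynomial X ℕ), MvPolynomial.coeff_C_mul,
    MvPolynomial.coeff_monomial, Equiv.apply_eq_iff_eq] at hcoeff
  rw [Finset.card_filter]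
  rw [Finset.sum_congr rfl fun q _ => mul_ite_zero _ _ _,
    Finset.sum_ite_eq_of_mem' _ _ _ (by simp [hc])] at hcoeff
  simpa [funext_iff] using hcoeff.symm

lemma factorial_mul_pow_le_factorial_mul_pow (a b : ℕ) :
    a.factorial * a ^ b ≤ b.factorial * a ^ a := by
  rcases le_total a b with h | h
  · calc a.factorial * a ^ b = a.factorial * a ^ (b - a) * a ^ a := by
          rw [mul_assoc, ← pow_add, Nat.sub_add_cancel h]
      _ ≤ b.factorial * a ^ a :=
          Nat.mul_le_mul_right _ (Nat.factorial_mul_pow_sub_le_factorial h)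
  · have hdesc : a.factorial ≤ b.factorial * a ^ (a - b) := by
      rw [← Nat.factorial_mul_descFactorial (Nat.sub_le a b), Nat.sub_sub_self h]
      exact Nat.mul_le_mul_left _ (Nat.descFactorial_le_pow _ _)
    calc a.factorial * a ^ b ≤ b.factorial * a ^ (a - b) * a ^ b := Nat.mul_le_mul_right _ hdesc
      _ = b.factorial * a ^ a := by rw [mul_assoc, ← pow_add, Nat.sub_add_cancel h]

/-- Among all type classes, the one of `c` has the largest weight under `c^{⊗n}`. -/
lemma multinomial_mul_prod_pow_le {X : Type*} [Fintype X] (c q : X → ℕ)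
    (h : ∑ x, q x = ∑ x, c x) :
    Nat.multinomial Finset.univ q * ∏ x, c x ^ q x ≤
      Nat.multinomial Finset.univ c * ∏ x, c x ^ c x := by
  have hprod : (∏ x, (c x).factorial) * ∏ x, c x ^ q x ≤
      (∏ x, (q x).factorial) * ∏ x, c x ^ c x := by
    simp only [← Finset.prod_mul_distrib]
    exact Finset.prod_le_prod' fun x _ => factorial_mul_pow_le_factorial_mul_pow _ _
  have hq := Nat.multinomial_spec Finset.univ q
  have hc := Nat.multinomial_spec Finset.univ c
  rw [h, ← hc] at hq
  have hpos : 0 < (∏ x, (q x).factorial) * ∏ x, (c x).factorial :=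
    Nat.mul_pos (Finset.prod_pos fun x _ => Nat.factorial_pos _)
      (Finset.prod_pos fun x _ => Nat.factorial_pos _)
  refine Nat.le_of_mul_le_mul_left ?_ hpos
  calc _ = ((∏ x, (q x).factorial) * Nat.multinomial Finset.univ q) *
        ((∏ x, (c x).factorial) * ∏ x, c x ^ q x) := by ring
    _ ≤ ((∏ x, (c x).factorial) * Nat.multinomial Finset.univ c) *
        ((∏ x, (q x).factorial) * ∏ x, c x ^ c x) := by
        rw [hq]; exact Nat.mul_le_mul_left _ hprod
    _ = _ := by ring

/-- There are at most `(n+1)^{|X|}` types of length `n`. -/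
lemma card_piAntidiag_le {X : Type*} [Fintype X] [DecidableEq X] (n : ℕ) :
    (Finset.piAntidiag (Finset.univ : Finset X) n).card ≤ (n + 1) ^ Fintype.card X := by
  have hsub : Finset.piAntidiag (Finset.univ : Finset X) n ⊆
      Fintype.piFinset fun _ : X => Finset.range (n + 1) := by
    intro q hq
    rw [Finset.mem_piAntidiag] at hq
    rw [Fintype.mem_piFinset]
    intro x
    rw [Finset.mem_range, Nat.lt_succ_iff, ← hq.1]
    exact Finset.single_le_sum (fun _ _ => Nat.zero_le _) (Finset.mem_univ x)
  simpa using Finset.card_le_card hsub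

/-- The weight of the type class of `c` under the `n`-fold power of its normalisation is at
least `(n+1)^{-|X|}`; here cleared of denominators. -/
lemma pow_le_pow_mul_multinomial_mul_prod {X : Type*} [Fintype X] (c : X → ℕ) {n : ℕ}
    (hc : ∑ x, c x = n) :
    n ^ n ≤ (n + 1) ^ Fintype.card X *
      (Nat.multinomial Finset.univ c * ∏ x, c x ^ c x) := by
  calc n ^ n = (∑ x, c x) ^ n := by rw [hc]
    _ = ∑ q ∈ Finset.piAntidiag Finset.univ n,
          Nat.multinomial Finset.univ q * ∏ x, c x ^ q x := by
        rw [Finset.sum_pow_eq_sum_piAntidiag]; simp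
    _ ≤ (Finset.piAntidiag (Finset.univ : Finset X) n).card •
          (Nat.multinomial Finset.univ c * ∏ x, c x ^ c x) := by
        refine Finset.sum_le_card_nsmul _ _ _ fun q hq => multinomial_mul_prod_pow_le c q ?_
        rw [(Finset.mem_piAntidiag.mp hq).1, hc]
    _ ≤ _ := by
        rw [smul_eq_mul]
        exact Nat.mul_le_mul_right _ (card_piAntidiag_le n)

/-- **Operator inequality between i.i.d. mixtures and type-class averages:**
`(Σ_x V(x) σ_x)^{⊗n} ≥ V^{⊗n}(T_{n,V}) · γ_{n,V} ≥ (n+1)^{−|X|} γ_{n,V}`. -/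
theorem type_class_operator_bound {X : Type*} [Fintype X] [DecidableEq X] (d : ℕ)
    (σ : X → MatC (Fin d)) (hσ : ∀ x, IsState (σ x))
    (n : ℕ) (hn : 1 ≤ n)
    (V : X → ℝ) (hV_nonneg : ∀ x, 0 ≤ V x) (hV_sum : (∑ x, V x) = 1)
    (hV_type : ∀ x, ∃ m : ℕ, (n : ℝ) * V x = m)
    (T : Finset (Fin n → X))
    (hT : ∀ s : Fin n → X, s ∈ T ↔ ∀ x : X,
      (((Finset.univ.filter fun k : Fin n => s k = x).card : ℝ) = (n : ℝ) * V x))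
    (γ : MatN (Fin d) n)
    (hγ : γ = ((T.card : ℂ))⁻¹ • ∑ s ∈ T, tensorProdFam (fun k => σ (s k))) :
    loewnerLE ((((∑ s ∈ T, ∏ k, V (s k) : ℝ)) : ℂ) • γ)
        (tensorPow (∑ x, ((V x : ℝ) : ℂ) • σ x) n) ∧
    loewnerLE (((((((n : ℝ) + 1) ^ Fintype.card X)⁻¹ : ℝ)) : ℂ) • γ)
        ((((∑ s ∈ T, ∏ k, V (s k) : ℝ)) : ℂ) • γ) := by
  have hpsd : ∀ s : Fin n → X, (tensorProdFam fun k => σ (s k)).PosSemidef := fun s =>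
    posSemidef_tensorProdFam fun k => (hσ (s k)).1
  have hγ_psd : γ.PosSemidef := by
    rw [hγ]
    exact (Matrix.posSemidef_sum T fun s _ => hpsd s).smul (by positivity)
  have hn0 : (0 : ℝ) < n := by exact_mod_cast hn
  choose c hc using hV_type
  have hc_sum : ∑ x, c x = n := by
    have : ((∑ x, c x : ℕ) : ℝ) = n := by
      push_cast
      simp_rw [← hc, ← Finset.mul_sum, hV_sum, mul_one]
    exact_mod_cast this
  have hmem : ∀ s : Fin n → X, s ∈ T ↔
      ∀ x, (Finset.univ.filter fun k : Fin n => s k = x).card = c x := by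
    intro s
    rw [hT]
    simp_rw [hc, Nat.cast_inj]
  have hT_card : T.card = Nat.multinomial Finset.univ c := by
    rw [← card_typeClass c hc_sum]
    congr 1
    ext s
    simp [hmem]
  have hweight : ∀ s ∈ T, ∏ k, V (s k) = ∏ x, V x ^ c x := by
    intro s hs
    rw [prod_comp_eq_prod_pow_card]
    exact Finset.prod_congr rfl fun x _ => by rw [(hmem s).mp hs x]
  have hT0 : (T.card : ℂ) ≠ 0 := by
    rw [hT_card]
    exact_mod_cast (Nat.multinomial_pos _ _).ne'
  constructor
  · have hsmul : (((∑ s ∈ T, ∏ k, V (s k) : ℝ)) : ℂ) • γ =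
        ∑ s ∈ T, (∏ k, (V (s k) : ℂ)) • tensorProdFam (fun k => σ (s k)) := by
      have hterm : ∀ s ∈ T, (∏ k, (V (s k) : ℂ)) • tensorProdFam (fun k => σ (s k)) =
          ((∏ x, V x ^ c x : ℝ) : ℂ) • tensorProdFam (fun k => σ (s k)) := by
        intro s hs
        rw [← hweight s hs, Complex.ofReal_prod]
      rw [Finset.sum_congr rfl hterm, ← Finset.smul_sum, Finset.sum_congr rfl hweight,
        Finset.sum_const, nsmul_eq_mul, hγ, smul_smul]
      congr 1
      push_cast
      field_simp
    rw [loewnerLE, tensorPow_sum_smul, hsmul, ← Finset.sum_compl_add_sum T, add_sub_cancel_right]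
    refine Matrix.posSemidef_sum _ fun s _ => (hpsd s).smul ?_
    rw [← Complex.ofReal_prod]
    exact Complex.zero_le_real.mpr (Finset.prod_nonneg fun k _ => hV_nonneg _)
  · rw [loewnerLE, ← sub_smul, ← Complex.ofReal_sub]
    refine hγ_psd.smul (Complex.zero_le_real.mpr (sub_nonneg.mpr ?_))
    have hV : ∀ x, V x = c x / n := fun x => by rw [← hc]; field_simp
    have hprod : ∏ x, V x ^ c x = (∏ x, (c x : ℝ) ^ c x) / (n : ℝ) ^ n := by
      simp_rw [hV, div_pow]
      rw [Finset.prod_div_distrib, Finset.prod_pow_eq_pow_sum, hc_sum]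
    have hbound : (n : ℝ) ^ n ≤ ((n : ℝ) + 1) ^ Fintype.card X *
        (Nat.multinomial Finset.univ c * ∏ x, (c x : ℝ) ^ c x) := by
      exact_mod_cast pow_le_pow_mul_multinomial_mul_prod c hc_sum
    rw [Finset.sum_congr rfl hweight, Finset.sum_const, nsmul_eq_mul, hT_card, hprod,
      ← mul_div_assoc, le_div_iff₀ (by positivity), inv_mul_le_iff₀ (by positivity)]
    exact hbound

end QSanov
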